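/- Let H be a finite-dimensional unimodular Hopf algebra with two-sided integral Λ, normalized so that λ_l(Λ) = 1 for a left integral λ_l on the dual. Then Λ belongs to the Higman ideal ad Λ(H) if and only if H is semisimple (equivalently, ε(Λ) ≠ 0). -/

import Mathlib

open TensorProduct

/-- The left Hopf-adjoint action `ad h a = Σ h₁ a S(h₂)`. -/
noncomputable def ad {k H : Type*} [Field k] [Ring H] [HopfAlgebra k H] (h a : H) : H :=
  TensorProduct.lift ((LinearMap.mul k H).compl₂
      ((LinearMap.mulLeft k a).comp (HopfAlgebra.antipode (R := k))))
    (Coalgebra.comul (R := k) h)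

/-- Convolution product on the dual `H* = Hom_k(H, k)`:  `(f * g)(h) = Σ f(h₁) g(h₂)`. -/
noncomputable def conv {k H : Type*} [Field k] [Ring H] [HopfAlgebra k H]
    (f g : H →ₗ[k] k) : H →ₗ[k] k :=
  (TensorProduct.lift ((LinearMap.mul k k).compl₁₂ f g)) ∘ₗ Coalgebra.comul (R := k)

namespace Stmt6Aux

open Coalgebra HopfAlgebra

variable {k H : Type*} [Field k] [Ring H] [HopfAlgebra k H]

/-- `id ⊗ l`. -/
noncomputable def Q (l : H →ₗ[k] k) : H ⊗[k] H →ₗ[k] H :=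
  TensorProduct.lift ((LinearMap.lsmul k H).flip.compl₂ l)

/-- `l ⊗ id`. -/
noncomputable def P (l : H →ₗ[k] k) : H ⊗[k] H →ₗ[k] H :=
  TensorProduct.lift ((LinearMap.lsmul k H).comp l)

@[simp] lemma Q_tmul (l : H →ₗ[k] k) (a b : H) : Q l (a ⊗ₜ b) = l b • a := by simp [Q]
@[simp] lemma P_tmul (l : H →ₗ[k] k) (a b : H) : P l (a ⊗ₜ b) = l a • b := by simp [P]

lemma Q_left (l : H →ₗ[k] k) (a : H) (t : H ⊗[k] H) : Q l ((a ⊗ₜ 1) * t) = a * Q l t := by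
  induction t with
  | zero => simp
  | add x y hx hy => simp [mul_add, hx, hy]
  | tmul x y => simp

lemma P_left (l : H →ₗ[k] k) (a : H) (t : H ⊗[k] H) : P l ((1 ⊗ₜ a) * t) = a * P l t := by
  induction t with
  | zero => simp
  | add x y hx hy => simp [mul_add, hx, hy]
  | tmul x y => simp

lemma P_right (l : H →ₗ[k] k) (a : H) (t : H ⊗[k] H) : P l (t * (1 ⊗ₜ a)) = P l t * a := by
  induction t with
  | zero => simp
  | add x y hx hy => simp [add_mul, hx, hy]
  | tmul x y => simp

lemma QP1 (l : H →ₗ[k] k) (g h : H) (t : H ⊗[k] H) :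
    l (h * Q l ((1 ⊗ₜ g) * t)) = l (g * P l ((h ⊗ₜ 1) * t)) := by
  induction t with
  | zero => simp
  | add x y hx hy => simp [mul_add, hx, hy]
  | tmul x y => simp [mul_comm]

lemma QP2 (l : H →ₗ[k] k) (g h : H) (t : H ⊗[k] H) :
    l (Q l ((1 ⊗ₜ g) * t) * h) = l (g * P l (t * (h ⊗ₜ 1))) := by
  induction t with
  | zero => simp
  | add x y hx hy => simp [mul_add, add_mul, hx, hy]
  | tmul x y => simp [mul_comm]

lemma sum_smul_counit (h : H) (r : Repr k h (H × H)) :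
    ∑ i ∈ r.index, counit (R := k) (r.right i) • r.left i = h := by
  have := congrArg (TensorProduct.rid k H) (sum_tmul_counit_eq r)
  rw [map_sum] at this
  simpa only [TensorProduct.rid_tmul, one_smul] using this

lemma lemE (h : H) (r : Repr k h (H × H)) :
    ∑ i ∈ r.index, comul (R := k) (r.left i) * (1 ⊗ₜ antipode k (r.right i)) = h ⊗ₜ[k] (1 : H) := by
  have h1 := sum_tmul_tmul_eq r (fun i => ℛ k (r.left i)) (fun i => ℛ k (r.right i))
  have h2 := congrArg (LinearMap.lTensor H (LinearMap.mul' k H ∘ₗ (antipode k).lTensor H)) h1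
  simp only [map_sum, LinearMap.lTensor_tmul, LinearMap.comp_apply, LinearMap.mul'_apply] at h2
  calc _ = _ := Finset.sum_congr rfl fun i _ => by
        rw [← (ℛ k (r.left i)).eq, Finset.sum_mul]
        simp only [Algebra.TensorProduct.tmul_mul_tmul, mul_one]
    _ = _ := h2
    _ = _ := by
      simp only [← tmul_sum, sum_mul_antipode_eq_smul, tmul_smul]
      simp only [smul_tmul', ← sum_tmul, sum_smul_counit]

lemma lemF (h : H) (r : Repr k h (H × H)) :
    ∑ i ∈ r.index, (antipode k (r.left i) ⊗ₜ 1) * comul (R := k) (r.right i) = (1 : H) ⊗ₜ[k] h := by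
  have h1 := sum_tmul_tmul_eq r (fun i => ℛ k (r.left i)) (fun i => ℛ k (r.right i))
  have h2 := congrArg ((LinearMap.rTensor H (LinearMap.mul' k H ∘ₗ (antipode k).rTensor H)) ∘ₗ
    (TensorProduct.assoc k H H H).symm.toLinearMap) h1
  simp only [map_sum, LinearMap.rTensor_tmul, LinearMap.comp_apply, LinearMap.mul'_apply,
    LinearEquiv.coe_coe, TensorProduct.assoc_symm_tmul] at h2
  calc _ = _ := Finset.sum_congr rfl fun i _ => by
        rw [← (ℛ k (r.right i)).eq, Finset.mul_sum]
        simp only [Algebra.TensorProduct.tmul_mul_tmul, one_mul]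
    _ = _ := h2.symm
    _ = _ := by
      simp only [← sum_tmul, sum_antipode_mul_eq_smul]
      simp only [smul_tmul, ← tmul_sum, sum_counit_smul]

lemma lemD (L : H) (hr : ∀ h : H, L * h = counit (R := k) h • L) (h : H) :
    comul (R := k) L * (h ⊗ₜ 1) = comul (R := k) L * (1 ⊗ₜ antipode k h) := by
  rw [← lemE h (ℛ k h), Finset.mul_sum]
  simp only [← mul_assoc, ← Bialgebra.comul_mul, hr, map_smul]
  conv_rhs => rw [← sum_counit_smul (ℛ k h)]
  simp [Finset.mul_sum, tmul_sum]

lemma lemC (L : H) (hl : ∀ h : H, h * L = counit (R := k) h • L) (h : H) :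
    (1 ⊗ₜ h) * comul (R := k) L = (antipode k h ⊗ₜ 1) * comul (R := k) L := by
  rw [← lemF h (ℛ k h), Finset.sum_mul]
  simp only [mul_assoc, ← Bialgebra.comul_mul, hl, map_smul]
  have e : ∑ i ∈ (ℛ k h).index, counit (R := k) ((ℛ k h).right i) • (ℛ k h).left i = h :=
    sum_smul_counit h _
  conv_rhs => rw [← e]
  simp [Finset.sum_mul, sum_tmul, ← smul_tmul']

lemma Q_comul (l : H →ₗ[k] k) (hl : ∀ f : H →ₗ[k] k, conv f l = f 1 • l) (h : H) :
    Q l (comul (R := k) h) = l h • (1 : H) := by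
  rw [← sub_eq_zero, ← Module.forall_dual_apply_eq_zero_iff k]
  intro f
  have h1 := LinearMap.congr_fun (hl f) h
  have h2 : ∀ t : H ⊗[k] H, f (Q l t) = TensorProduct.lift ((LinearMap.mul k k).compl₁₂ f l) t := by
    intro t
    induction t with
    | zero => simp
    | add x y hx hy => simp [hx, hy]
    | tmul x y => simp [mul_comm]
  have h3 : f (Q l (comul (R := k) h)) = f 1 * l h := by
    rw [h2]; exact h1
  rw [map_sub, h3]
  simp [mul_comm]

lemma Q_one_tmul_L (l : H →ₗ[k] k) (hl : ∀ f : H →ₗ[k] k, conv f l = f 1 • l)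
    (L : H) (hL : ∀ h : H, L * h = counit (R := k) h • L) (hn : l L = 1) (h : H) :
    ∑ i ∈ (ℛ k L).index, l ((ℛ k L).right i * h) • antipode k ((ℛ k L).left i) = h := by
  have h1 : Q l ((1 ⊗ₜ L) * comul (R := k) h) = h := by
    rw [← (ℛ k h).eq, Finset.mul_sum, map_sum]
    simp only [Algebra.TensorProduct.tmul_mul_tmul, Q_tmul, hL, map_smul, hn, one_mul]
    simpa using sum_smul_counit h (ℛ k h)
  conv_rhs => rw [← h1, ← lemF L (ℛ k L), Finset.sum_mul, map_sum]
  simp only [mul_assoc, ← Bialgebra.comul_mul, Q_left, Q_comul l hl]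
  simp

end Stmt6Aux

open Stmt6Aux Coalgebra HopfAlgebra in
/-- let `H` be a finite-dimensional unimodular Hopf algebra with two-sided
integral `Λ`, normalized so that `λ_l Λ = 1` where `λ_l` is a left integral of the dual
Hopf algebra.  Then `Λ` belongs to the Higman ideal `ad Λ (H)` if and only if `H` is
semisimple, equivalently `ε(Λ) ≠ 0`. -/
theorem stmt_6 {k H : Type*} [Field k] [Ring H] [HopfAlgebra k H]
    [FiniteDimensional k H]
    (Λ : H)
    (hΛl : ∀ h : H, h * Λ = Coalgebra.counit (R := k) h • Λ)
    (hΛr : ∀ h : H, Λ * h = Coalgebra.counit (R := k) h • Λ)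
    (laml : H →ₗ[k] k)
    (hlaml : ∀ f : H →ₗ[k] k, conv f laml = f 1 • laml)
    (hnorm : laml Λ = 1) :
    (∃ x : H, Λ = ad (k := k) Λ x) ↔ Coalgebra.counit (R := k) Λ ≠ 0 := by
  have had : ∀ x, ad (k := k) Λ x =
      ∑ i ∈ (ℛ k Λ).index, (ℛ k Λ).left i * (x * antipode k ((ℛ k Λ).right i)) := by
    intro x
    unfold ad
    rw [← (ℛ k Λ).eq, map_sum]
    simp
  constructor
  · rintro ⟨x, hx⟩ h0
    have hA := Q_one_tmul_L laml hlaml Λ hΛr hnorm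
    set S := antipode k (A := H) with hS
    have Ssurj : Function.Surjective S := fun h => by
      refine ⟨∑ i ∈ (ℛ k Λ).index, laml ((ℛ k Λ).right i * h) • (ℛ k Λ).left i, ?_⟩
      rw [map_sum]
      simpa using hA h
    have Sinj : Function.Injective S := LinearMap.injective_iff_surjective.2 Ssurj
    -- nondegeneracy
    have hnd : ∀ a : H, (∀ y, laml (a * y) = 0) → a = 0 := by
      let B : H →ₗ[k] Module.Dual k H := (LinearMap.mul k H).flip.compr₂ laml
      have hB : ∀ a b, B a b = laml (b * a) := fun a b => rfl
      have Binj : Function.Injective B := by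
        rw [← LinearMap.ker_eq_bot, LinearMap.ker_eq_bot']
        intro h hh
        rw [← hA h]
        refine Finset.sum_eq_zero fun i _ => ?_
        rw [← hB, hh]; simp
      have Bsurj : Function.Surjective B :=
        (LinearMap.injective_iff_surjective_of_finrank_eq_finrank
          Subspace.dual_finrank_eq.symm).1 Binj
      intro a ha
      rw [← Module.forall_dual_apply_eq_zero_iff k]
      intro f
      obtain ⟨y, rfl⟩ := Bsurj f
      exact ha y
    have hBB : ∀ g, Q laml ((1 ⊗ₜ g) * comul (R := k) Λ) = S g := by
      intro g
      rw [lemC Λ hΛl, Q_left, Q_comul laml hlaml, hnorm]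
      simp
      rfl
    set u := P laml (comul (R := k) Λ) with hu
    have h3 : ∀ g h, laml (S h * S g) = laml (g * (h * u)) := by
      intro g h
      rw [← hBB g, QP1, ← lemC Λ hΛl, P_left]
    have h4 : ∀ g h, laml (S g * h) = laml (g * (u * S h)) := by
      intro g h
      rw [← hBB g, QP2, lemD Λ hΛr, P_right]
    have uinj : Function.Injective (LinearMap.mulRight k u) := by
      rw [← LinearMap.ker_eq_bot, LinearMap.ker_eq_bot']
      intro g hg
      have : S g = 0 := by
        apply hnd
        intro y
        obtain ⟨y, rfl⟩ := Ssurj y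
        rw [h3]
        have : g * u = 0 := hg
        simp [this]
      exact Sinj (by simpa using this)
    have usurj := LinearMap.injective_iff_surjective.1 uinj
    have nak : ∀ h y, laml (h * y) = laml (y * S (S h)) := by
      intro h y
      obtain ⟨g, rfl⟩ := usurj y
      have e : laml (S g * S h) = laml (h * (g * u)) := h3 h g
      simp only [LinearMap.mulRight_apply]
      rw [← e, h4, mul_assoc]
    have key : laml (ad (k := k) Λ x) = 0 := by
      obtain ⟨T, hT⟩ := Ssurj.hasRightInverse
      have : ∑ i ∈ (ℛ k Λ).index, T ((ℛ k Λ).right i) * (ℛ k Λ).left i = 0 := by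
        apply Sinj
        rw [map_sum, map_zero]
        simp only [hS, antipode_mul_antidistrib]
        rw [← hS]
        simp only [hT _]
        rw [hS, sum_antipode_mul_eq_smul, h0, zero_smul]
      rw [had, map_sum]
      calc _ = ∑ i ∈ (ℛ k Λ).index, laml (T ((ℛ k Λ).right i) * (ℛ k Λ).left i * x) := by
            refine Finset.sum_congr rfl fun i _ => ?_
            rw [mul_assoc (T _), nak (T _), hT, mul_assoc]
        _ = 0 := by rw [← map_sum, ← Finset.sum_mul, this]; simp
    rw [← hx, hnorm] at key
    exact one_ne_zero key
  · intro h0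
    refine ⟨(counit (R := k) Λ)⁻¹ • Λ, ?_⟩
    rw [had]
    have e := congrArg (fun z => counit (R := k) z) (sum_mul_antipode_eq_smul (ℛ k Λ))
    simp only [map_sum, Bialgebra.counit_mul, counit_antipode, map_smul, Bialgebra.counit_one] at e
    simp only [smul_mul_assoc, hΛr, mul_smul_comm, hΛl, counit_antipode]
    simp only [smul_smul, ← Finset.sum_smul]
    have : ∑ i ∈ (ℛ k Λ).index, (counit (R := k) Λ)⁻¹ * (counit (R := k) ((ℛ k Λ).right i) *
        counit (R := k) ((ℛ k Λ).left i)) = 1 := by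
      rw [← Finset.mul_sum]
      simp only [mul_comm (counit (R := k) ((ℛ k Λ).right _)), e]
      simp [h0]
    simp only [mul_assoc, this, one_smul]
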